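/- Let d ≥ 1, α ∈ (0,2], γ > 0 and β_1, …, β_d > 0, and set Q = Σ_{l=1}^d β_l^{−1}. Then ∫_{ℝ^d} | ∫_{[−1,1]^d} ( Σ_{l=1}^d |x_l − y_l|^{β_l} )^{−γ} dx |^α dy < ∞ if and only if αγ > Q > γ. Moreover, for the anisotropic coefficients a_i = (Σ_{l=1}^d |i_l|^{β_l})^{−γ} (i ∈ ℤ^d \ {0}): Σ_{i} |a_i| = ∞ if and only if γ ≤ Q, and αγ > Q implies Σ_i (Σ_{l=1}^d |i_l|^{β_l})^{−αγ} L((Σ_{l=1}^d |i_l|^{β_l})^{γ}) < ∞ for any function L slowly varying at infinity arising as the truncated second-moment function of an innovation in the domain of attraction of an α-stable law. -/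

import Mathlib

open MeasureTheory Filter Topology

noncomputable section

/-- A function is slowly varying at infinity. -/
def SlowlyVarying (L : ℝ → ℝ) : Prop :=
  ∀ c : ℝ, 0 < c → Tendsto (fun x => L (c * x) / L x) atTop (nhds 1)


lemma aux_int (p : ℝ) (hp1 : p < 1) (a b : ℝ) :
    IntervalIntegrable (fun u : ℝ => |u| ^ (-p)) volume a b := by
  have h0 : ∀ x : ℝ, 0 < x → IntervalIntegrable (fun u : ℝ => |u| ^ (-p)) volume 0 x := by
    intro x hx
    have h := intervalIntegral.intervalIntegrable_rpow' (a := 0) (b := x) (r := -p) (by linarith)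
    refine h.congr ?_
    intro u hu
    rw [Set.uIoc_of_le hx.le] at hu
    simp only [abs_of_pos hu.1]
  exact intervalIntegrable_of_even (fun x => by simp) h0

lemma aux_intOn (p : ℝ) (hp1 : p < 1) (t : ℝ) :
    IntegrableOn (fun x : ℝ => |x - t| ^ (-p)) (Set.Icc (-1) 1) := by
  have := (aux_int p hp1 (-1 - t) (1 - t)).comp_sub_right t
  simp only [sub_add_cancel] at this
  rwa [intervalIntegrable_iff_integrableOn_Icc_of_le (by norm_num)] at this

lemma aux_bound (p : ℝ) (hp : 0 < p) (hp1 : p < 1) :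
    ∃ C : ℝ, 0 < C ∧ ∀ t : ℝ,
      ∫ x in Set.Icc (-1:ℝ) 1, |x - t| ^ (-p) ≤ C * (1 + |t|) ^ (-p) := by
  set K := ∫ u in (-3:ℝ)..3, |u| ^ (-p) with hK
  have hK0 : 0 ≤ K := intervalIntegral.integral_nonneg (by norm_num) (fun u _ => by positivity)
  refine ⟨(K + 2) * 3 ^ p, by positivity, fun t => ?_⟩
  have hC : (K + 2) * 3 ^ p * (1 + |t|) ^ (-p) = (K + 2) * ((1 + |t|) / 3) ^ (-p) := by
    rw [Real.div_rpow (by positivity) (by norm_num), Real.rpow_neg (by norm_num : (0:ℝ) ≤ 3)]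
    field_simp
  rw [hC]
  rcases le_total |t| 2 with h | h
  · have h1 : ∫ x in Set.Icc (-1:ℝ) 1, |x - t| ^ (-p) ≤ K := by
      rw [integral_Icc_eq_integral_Ioc, ← intervalIntegral.integral_of_le (by norm_num),
        intervalIntegral.integral_comp_sub_right (fun u => |u| ^ (-p))]
      rw [abs_le] at h
      apply intervalIntegral.integral_mono_interval (by linarith) (by linarith) (by linarith)
      · exact Eventually.of_forall (fun u => by simp only [Pi.zero_apply]; positivity)
      · exact aux_int p hp1 _ _
    have h2 : 1 ≤ ((1 + |t|) / 3) ^ (-p) :=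
      Real.one_le_rpow_of_pos_of_le_one_of_nonpos (by positivity) (by linarith) (by linarith)
    nlinarith
  · have h1 : ∫ x in Set.Icc (-1:ℝ) 1, |x - t| ^ (-p) ≤
        ∫ x in Set.Icc (-1:ℝ) 1, ((1 + |t|) / 3) ^ (-p) := by
      apply setIntegral_mono_on (aux_intOn p hp1 t) (by simp) measurableSet_Icc
      intro x hx
      apply Real.rpow_le_rpow_of_nonpos (by positivity) _ (by linarith)
      have hx' : |x| ≤ 1 := abs_le.2 hx
      have := abs_sub_abs_le_abs_sub t x
      rw [abs_sub_comm] at this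
      linarith
    have h3 : 0 ≤ ((1 + |t|) / 3) ^ (-p) := by positivity
    simp at h1
    nlinarith

lemma prod_rpow_le {d : ℕ} (β : Fin d → ℝ) (hβ : ∀ l, 0 < β l) (Q : ℝ)
    (hQ : Q = ∑ l, (β l)⁻¹) (hQ0 : 0 < Q) (s : ℝ) (hs : 0 < s) (u : Fin d → ℝ) (hu : ∀ l, 0 < u l)
    (r : ℝ) (hr0 : 0 < r) (hr : ∀ l, u l ^ β l ≤ r) :
    r ^ (-s) ≤ ∏ l, u l ^ (-(s / Q)) := by
  have h1 : r ^ (-s) = ∏ l, r ^ (-(s/Q) * (β l)⁻¹) := by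
    rw [← Real.rpow_sum_of_pos hr0, ← Finset.mul_sum, ← hQ]
    congr 1; field_simp
  rw [h1]
  apply Finset.prod_le_prod (fun l _ => by positivity)
  intro l _
  have hb := hβ l
  have h2 : u l ^ (-(s/Q)) = (u l ^ β l) ^ (-(s/Q) * (β l)⁻¹) := by
    rw [← Real.rpow_mul (hu l).le]; congr 1; field_simp
  rw [h2]
  have hul := hu l
  apply Real.rpow_le_rpow_of_nonpos (by positivity) (hr l)
  have : 0 < s / Q * (β l)⁻¹ := by positivity
  linarith

lemma part_i_fin {d : ℕ} (hd : 0 < d) (α γ : ℝ) (hα : 0 < α) (hγ : 0 < γ)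
    (β : Fin d → ℝ) (hβ : ∀ l, 0 < β l) (Q : ℝ) (hQ : Q = ∑ l, (β l)⁻¹) (hQ0 : 0 < Q)
    (h1 : Q < α * γ) (h2 : γ < Q) :
    (∫⁻ y : Fin d → ℝ,
        (∫⁻ x in Set.univ.pi fun _ => Set.Icc (-1:ℝ) 1,
          ENNReal.ofReal ((∑ l, |x l - y l| ^ β l) ^ (-γ))) ^ α) < ⊤ := by
  have hp : 0 < γ / Q := by positivity
  have hp1 : γ / Q < 1 := (div_lt_one hQ0).2 h2
  obtain ⟨C, hC, hb⟩ := aux_bound (γ / Q) hp hp1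
  have key : ∀ y : Fin d → ℝ, (∫⁻ x in Set.univ.pi fun _ => Set.Icc (-1:ℝ) 1,
          ENNReal.ofReal ((∑ l, |x l - y l| ^ β l) ^ (-γ))) ^ α ≤
        ENNReal.ofReal (∏ l, C ^ α * (1 + ‖y l‖) ^ (-(γ / Q * α))) := by
    intro y
    have hIntg : Integrable (fun x : Fin d → ℝ => ∏ l, |x l - y l| ^ (-(γ / Q)))
        (Measure.pi fun _ => volume.restrict (Set.Icc (-1:ℝ) 1)) :=
      Integrable.fintype_prod (f := fun l x => |x - y l| ^ (-(γ / Q)))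
        (fun l => aux_intOn _ hp1 (y l))
    have hF : (∫⁻ x in Set.univ.pi fun _ => Set.Icc (-1:ℝ) 1,
          ENNReal.ofReal ((∑ l, |x l - y l| ^ β l) ^ (-γ))) ≤
          ENNReal.ofReal (∏ l, C * (1 + |y l|) ^ (-(γ / Q))) := by
      calc _ ≤ ∫⁻ x in Set.univ.pi fun _ => Set.Icc (-1:ℝ) 1,
          ENNReal.ofReal (∏ l, |x l - y l| ^ (-(γ / Q))) := by
            apply lintegral_mono_ae
            apply ae_restrict_of_ae
            have hne : ∀ᵐ x : Fin d → ℝ, ∀ l, x l ≠ y l := by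
              rw [ae_all_iff]; intro l
              exact Measure.ae_eval_ne (fun _ => volume) _ _
            filter_upwards [hne] with x hx
            apply ENNReal.ofReal_le_ofReal
            have hpos : ∀ l, 0 < |x l - y l| := fun l => abs_pos.2 (sub_ne_zero.2 (hx l))
            have hle : ∀ l, |x l - y l| ^ β l ≤ ∑ l, |x l - y l| ^ β l := fun l =>
              Finset.single_le_sum (f := fun l => |x l - y l| ^ β l)
                (fun i _ => by positivity) (Finset.mem_univ l)
            refine prod_rpow_le β hβ Q hQ hQ0 γ hγ _ hpos _ ?_ hle
            exact (Real.rpow_pos_of_pos (hpos ⟨0, hd⟩) _).trans_le (hle _)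
        _ = ENNReal.ofReal (∏ l, ∫ x in Set.Icc (-1:ℝ) 1, |x - y l| ^ (-(γ / Q))) := by
            rw [volume_pi, Measure.restrict_pi_pi, ← ofReal_integral_eq_lintegral_ofReal hIntg
              (Eventually.of_forall fun x => Finset.prod_nonneg (fun l _ => by positivity)),
              integral_fintype_prod_eq_prod (f := fun l x => |x - y l| ^ (-(γ / Q)))]
        _ ≤ _ := by
            apply ENNReal.ofReal_le_ofReal
            apply Finset.prod_le_prod
            · intro l _
              exact integral_nonneg (fun x => by positivity)
            · intro l _; exact hb _
    refine (ENNReal.rpow_le_rpow hF hα.le).trans ?_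
    rw [ENNReal.ofReal_rpow_of_nonneg (Finset.prod_nonneg fun l _ => by positivity) hα.le,
      ← Real.finsetProd_rpow _ _ (fun l _ => by positivity)]
    apply le_of_eq
    congr 1
    apply Finset.prod_congr rfl
    intro l _
    rw [Real.mul_rpow hC.le (by positivity), ← Real.rpow_mul (by positivity), Real.norm_eq_abs]
    congr 2; ring
  refine (lintegral_mono key).trans_lt ?_
  apply Integrable.lintegral_lt_top
  rw [volume_pi]
  apply Integrable.fintype_prod (f := fun (_ : Fin d) t => C ^ α * (1 + ‖t‖) ^ (-(γ / Q * α)))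
  intro l
  apply Integrable.const_mul
  apply integrable_one_add_norm
  simp
  rw [div_mul_eq_mul_div, lt_div_iff₀ hQ0]
  linarith

lemma vol_box {d : ℕ} (β : Fin d → ℝ) (Q : ℝ)
    (hQ : Q = ∑ l, (β l)⁻¹) (a : Fin d → ℝ) (t : ℝ) (ht : 0 < t) :
    volume (Set.Icc a (fun l => a l + t ^ (β l)⁻¹)) = ENNReal.ofReal (t ^ Q) := by
  rw [Real.volume_Icc_pi, hQ, Real.rpow_sum_of_pos ht,
    ENNReal.ofReal_prod_of_nonneg (fun l _ => by positivity)]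
  simp

lemma lintegral_top_of {X : Type*} [MeasurableSpace X] (μ : Measure X) (F : X → ENNReal)
    (S : ℕ → Set X) (hS : ∀ n, MeasurableSet (S n)) (k : ℕ → ENNReal)
    (hle : ∀ n, ∀ᵐ x ∂μ, x ∈ S n → k n ≤ F x)
    (hlim : ∀ᵐ x ∂μ, Tendsto (fun n => (S n).indicator (fun _ => k n) x) atTop (𝓝 0))
    (c : ENNReal) (hc : 0 < c) (hlow : ∀ n, c ≤ k n * μ (S n)) : ∫⁻ x, F x ∂μ = ⊤ := by
  by_contra hne
  have h := tendsto_lintegral_of_dominated_convergence (μ := μ)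
    (F := fun n x => (S n).indicator (fun _ => k n) x) (f := fun _ => 0) F
    (fun n => measurable_const.indicator (hS n))
    (fun n => by
      filter_upwards [hle n] with x hx
      by_cases hxs : x ∈ S n
      · simpa [hxs] using hx hxs
      · simp [hxs]) hne hlim
  simp only [lintegral_zero] at h
  have h2 : c ≤ 0 := by
    apply ge_of_tendsto h
    apply Eventually.of_forall
    intro n
    rw [lintegral_indicator_const (hS n)]
    exact hlow n
  exact absurd h2 (not_le.2 hc)

lemma inner_top {d : ℕ} (hd : 0 < d) (γ : ℝ) (hγ : 0 < γ)
    (β : Fin d → ℝ) (hβ : ∀ l, 0 < β l) (Q : ℝ) (hQ : Q = ∑ l, (β l)⁻¹)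
    (h2 : Q ≤ γ) (y : Fin d → ℝ) (hy : y ∈ Set.Icc (-1 : Fin d → ℝ) 0) :
    (∫⁻ x in Set.univ.pi fun _ => Set.Icc (-1:ℝ) 1,
          ENNReal.ofReal ((∑ l, |x l - y l| ^ β l) ^ (-γ))) = ⊤ := by
  have hd' : (0:ℝ) < d := by exact_mod_cast hd
  let t : ℕ → ℝ := fun n => ((n:ℝ) + 1)⁻¹
  have ht0 : ∀ n, 0 < t n := fun n => by positivity
  have ht1 : ∀ n, t n ≤ 1 := fun n => inv_le_one_of_one_le₀ (by simp)
  have htl : Tendsto t atTop (𝓝 0) := by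
    have := tendsto_one_div_add_atTop_nhds_zero_nat (𝕜 := ℝ)
    simpa [t] using this
  have hsub : ∀ n, Set.Icc y (fun l => y l + t n ^ (β l)⁻¹) ⊆
      Set.univ.pi fun _ => Set.Icc (-1:ℝ) 1 := by
    intro n x hx l _
    have a1 := hx.1 l
    have a2 := hx.2 l
    have a3 := hy.1 l
    have a4 := hy.2 l
    have a5 : t n ^ (β l)⁻¹ ≤ 1 := Real.rpow_le_one (ht0 n).le (ht1 n) (inv_nonneg.2 (hβ l).le)
    simp at a1 a2 a3 a4
    constructor <;> linarith
  have hyne : ∀ᵐ x : Fin d → ℝ ∂(volume.restrict (Set.univ.pi fun _ => Set.Icc (-1:ℝ) 1)),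
      x ⟨0, hd⟩ ≠ y ⟨0, hd⟩ := by
    apply ae_restrict_of_ae
    exact Measure.ae_eval_ne (fun _ => volume) _ _
  refine lintegral_top_of _ _ (fun n => Set.Icc y (fun l => y l + t n ^ (β l)⁻¹))
    (fun n => measurableSet_Icc) (fun n => ENNReal.ofReal ((d * t n) ^ (-γ))) ?_ ?_
    (ENNReal.ofReal ((d:ℝ) ^ (-γ))) (by simp; positivity) ?_
  · intro n
    filter_upwards [hyne] with x hx hxs
    apply ENNReal.ofReal_le_ofReal
    have hpos : 0 < |x ⟨0, hd⟩ - y ⟨0, hd⟩| := abs_pos.2 (sub_ne_zero.2 hx)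
    apply Real.rpow_le_rpow_of_nonpos _ _ (by linarith)
    · exact (Real.rpow_pos_of_pos hpos (β ⟨0, hd⟩)).trans_le
        (Finset.single_le_sum (f := fun l => |x l - y l| ^ β l)
                (fun i _ => by positivity) (Finset.mem_univ _))
    · have : ∀ l ∈ Finset.univ, |x l - y l| ^ β l ≤ t n := by
        intro l _
        have a1 := hxs.1 l
        have a2 := hxs.2 l
        simp only at a2
        rw [abs_of_nonneg (by linarith)]
        have hb := hβ l
        have := Real.rpow_le_rpow (by linarith) (by linarith : x l - y l ≤ t n ^ (β l)⁻¹) hb.le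
        rwa [Real.rpow_inv_rpow (ht0 n).le hb.ne'] at this
      simpa using Finset.sum_le_card_nsmul _ _ _ this
  · filter_upwards [hyne] with x hx
    apply tendsto_const_nhds.congr'
    have hb := hβ ⟨0, hd⟩
    have hpos : 0 < |x ⟨0, hd⟩ - y ⟨0, hd⟩| := abs_pos.2 (sub_ne_zero.2 hx)
    have h3 : Tendsto (fun n => t n ^ (β ⟨0, hd⟩)⁻¹) atTop (𝓝 0) := by
      have := htl.rpow_const (p := (β ⟨0, hd⟩)⁻¹) (Or.inr (by positivity))
      rwa [Real.zero_rpow (by positivity)] at this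
    filter_upwards [h3.eventually (gt_mem_nhds hpos)] with n hn
    symm
    apply Set.indicator_of_notMem
    intro hxs
    have a1 := hxs.1 ⟨0, hd⟩
    have a2 := hxs.2 ⟨0, hd⟩
    simp only at a2
    rw [abs_of_nonneg (by linarith)] at hn
    linarith
  · intro n
    rw [Measure.restrict_apply measurableSet_Icc, Set.inter_eq_left.2 (hsub n),
      vol_box β Q hQ y _ (ht0 n), ← ENNReal.ofReal_mul (by have := ht0 n; positivity)]
    apply ENNReal.ofReal_le_ofReal
    have := ht0 n
    rw [Real.mul_rpow hd'.le this.le, mul_assoc, ← Real.rpow_add this]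
    apply le_mul_of_one_le_right (by positivity)
    exact Real.one_le_rpow_of_pos_of_le_one_of_nonpos this (ht1 n) (by linarith)

lemma part_i_gamma {d : ℕ} (hd : 0 < d) (α γ : ℝ) (hα : 0 < α) (hγ : 0 < γ)
    (β : Fin d → ℝ) (hβ : ∀ l, 0 < β l) (Q : ℝ) (hQ : Q = ∑ l, (β l)⁻¹)
    (h2 : Q ≤ γ) :
    (∫⁻ y : Fin d → ℝ,
        (∫⁻ x in Set.univ.pi fun _ => Set.Icc (-1:ℝ) 1,
          ENNReal.ofReal ((∑ l, |x l - y l| ^ β l) ^ (-γ))) ^ α) = ⊤ := by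
  rw [eq_top_iff]
  calc (⊤ : ENNReal) = ∫⁻ y in Set.Icc (-1 : Fin d → ℝ) 0, ⊤ := by
        rw [setLIntegral_const, Real.volume_Icc_pi]; simp
    _ ≤ ∫⁻ y in Set.Icc (-1 : Fin d → ℝ) 0, (∫⁻ x in Set.univ.pi fun _ => Set.Icc (-1:ℝ) 1,
          ENNReal.ofReal ((∑ l, |x l - y l| ^ β l) ^ (-γ))) ^ α := by
        apply setLIntegral_mono' measurableSet_Icc
        intro y hy
        rw [inner_top hd γ hγ β hβ Q hQ h2 y hy, ENNReal.top_rpow_of_pos hα]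
    _ ≤ _ := setLIntegral_le_lintegral _ _

lemma part_i_alpha {d : ℕ} (hd : 0 < d) (α γ : ℝ) (hα : 0 < α) (hγ : 0 < γ)
    (β : Fin d → ℝ) (hβ : ∀ l, 0 < β l) (Q : ℝ) (hQ : Q = ∑ l, (β l)⁻¹)
    (h2 : α * γ ≤ Q) :
    (∫⁻ y : Fin d → ℝ,
        (∫⁻ x in Set.univ.pi fun _ => Set.Icc (-1:ℝ) 1,
          ENNReal.ofReal ((∑ l, |x l - y l| ^ β l) ^ (-γ))) ^ α) = ⊤ := by
  have : Nonempty (Fin d) := ⟨⟨0, hd⟩⟩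
  let t : ℕ → ℝ := fun n => (n:ℝ) + 1
  have ht1 : ∀ n, 1 ≤ t n := fun n => by simp [t]
  have ht0 : ∀ n, 0 < t n := fun n => by positivity
  have htl : Tendsto t atTop atTop := tendsto_atTop_add_const_right _ _ tendsto_natCast_atTop_atTop
  set C : ℝ := ∑ l, (2:ℝ) ^ β l with hC
  have hC0 : 0 < C := Finset.sum_pos (fun l _ => by positivity) Finset.univ_nonempty
  refine lintegral_top_of _ _ (fun n => Set.Icc (0 : Fin d → ℝ) (fun l => (0 : Fin d → ℝ) l + t n ^ (β l)⁻¹))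
    (fun n => measurableSet_Icc) (fun n => ENNReal.ofReal ((C * t n) ^ (-(γ * α)))) ?_ ?_
    (ENNReal.ofReal (C ^ (-(γ * α)))) (by simp; positivity) ?_
  · intro n
    apply Eventually.of_forall
    intro y hy
    have hCt : 0 < C * t n := mul_pos hC0 (ht0 n)
    have e : (C * t n) ^ (-(γ * α)) = ((C * t n) ^ (-γ)) ^ α := by
      rw [← Real.rpow_mul hCt.le]; congr 1; ring
    rw [e, ← ENNReal.ofReal_rpow_of_nonneg (by positivity) hα.le]
    apply ENNReal.rpow_le_rpow _ hα.le
    have hne : ∀ᵐ x : Fin d → ℝ, x ⟨0, hd⟩ ≠ y ⟨0, hd⟩ :=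
      Measure.ae_eval_ne (fun _ => volume) _ _
    have hms : MeasurableSet (Set.univ.pi fun _ : Fin d => Set.Icc (-1:ℝ) 1) :=
      MeasurableSet.univ_pi (fun _ => measurableSet_Icc)
    calc ENNReal.ofReal ((C * t n) ^ (-γ)) ≤
        ∫⁻ x in Set.univ.pi fun _ : Fin d => Set.Icc (-1:ℝ) 1, ENNReal.ofReal ((C * t n) ^ (-γ)) := by
          rw [setLIntegral_const, volume_pi_pi]
          apply le_mul_of_one_le_right (by positivity)
          apply Finset.one_le_prod''
          intro l
          rw [Real.volume_Icc]
          norm_num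
      _ ≤ _ := by
          apply lintegral_mono_ae
          filter_upwards [ae_restrict_of_ae hne, ae_restrict_mem hms] with x hx hxs
          apply ENNReal.ofReal_le_ofReal
          have hpos : 0 < |x ⟨0, hd⟩ - y ⟨0, hd⟩| := abs_pos.2 (sub_ne_zero.2 hx)
          apply Real.rpow_le_rpow_of_nonpos _ _ (by linarith)
          · exact (Real.rpow_pos_of_pos hpos (β ⟨0, hd⟩)).trans_le
              (Finset.single_le_sum (f := fun l => |x l - y l| ^ β l)
                (fun i _ => by positivity) (Finset.mem_univ _))
          · rw [hC, Finset.sum_mul]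
            apply Finset.sum_le_sum
            intro l _
            have hb := hβ l
            have a1 := hy.1 l
            have a2 := hy.2 l
            have a3 := hxs l (Set.mem_univ _)
            simp only [Pi.zero_apply, zero_add, Set.mem_Icc] at a1 a2 a3
            have a4 : 1 ≤ t n ^ (β l)⁻¹ := Real.one_le_rpow (ht1 n) (by positivity)
            have a5 : |x l - y l| ≤ 2 * t n ^ (β l)⁻¹ := by
              rw [abs_le]; constructor <;> linarith
            have := Real.rpow_le_rpow (abs_nonneg _) a5 hb.le
            rwa [Real.mul_rpow (by norm_num) (by linarith), Real.rpow_inv_rpow (ht0 n).le hb.ne'] at this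
  · apply Eventually.of_forall
    intro y
    have h3 : Tendsto (fun n => ENNReal.ofReal ((C * t n) ^ (-(γ * α)))) atTop (𝓝 0) := by
      rw [← ENNReal.ofReal_zero]
      apply ENNReal.tendsto_ofReal
      exact (tendsto_rpow_neg_atTop (by positivity)).comp (htl.const_mul_atTop hC0)
    refine tendsto_of_tendsto_of_tendsto_of_le_of_le tendsto_const_nhds h3 (fun _ => by simp) ?_
    intro n
    exact Set.indicator_le_self' (fun _ _ => by simp) y
  · intro n
    have := ht0 n
    rw [vol_box β Q hQ 0 _ (ht0 n), ← ENNReal.ofReal_mul (by positivity)]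
    apply ENNReal.ofReal_le_ofReal
    rw [Real.mul_rpow hC0.le this.le, mul_assoc, ← Real.rpow_add this]
    apply le_mul_of_one_le_right (by positivity)
    exact Real.one_le_rpow (ht1 n) (by linarith)

lemma summable_int_max (b : ℝ) (hb : 1 < b) :
    Summable (fun n : ℤ => (max 1 |(n:ℝ)|) ^ (-b)) := by
  have h1 := Real.summable_abs_int_rpow hb
  have h2 : Summable (fun n : ℤ => if n = 0 then (1:ℝ) else 0) :=
    summable_of_hasFiniteSupport ((Set.finite_singleton (0:ℤ)).subset (by
      intro n hn; by_contra h; simp at h; simp [h] at hn))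
  refine Summable.of_nonneg_of_le (fun n => by positivity) (fun n => ?_) (h1.add h2)
  by_cases hn : n = 0
  · subst hn
    have : (0:ℝ) ^ (-b) = 0 := Real.zero_rpow (by linarith)
    simp [this]
  · have : (1:ℝ) ≤ |(n:ℝ)| := by exact_mod_cast Int.one_le_abs hn
    simp [hn, max_eq_right this]

lemma summable_pi_prod {d : ℕ} (f : ℤ → ℝ) (hf0 : ∀ n, 0 ≤ f n) (hf : Summable f) :
    Summable (fun i : Fin d → ℤ => ∏ l, f (i l)) := by
  classical
  apply summable_of_sum_le (c := ∏ _l : Fin d, ∑' n, f n)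
  · intro i; exact Finset.prod_nonneg (fun l _ => hf0 _)
  · intro u
    calc ∑ i ∈ u, ∏ l, f (i l) ≤
        ∑ i ∈ Fintype.piFinset (fun l => u.image (fun i => i l)), ∏ l, f (i l) := by
          apply Finset.sum_le_sum_of_subset_of_nonneg
          · intro i hi
            rw [Fintype.mem_piFinset]
            intro l
            exact Finset.mem_image_of_mem _ hi
          · intro i _ _
            exact Finset.prod_nonneg (fun l _ => hf0 _)
      _ = ∏ l : Fin d, ∑ n ∈ u.image (fun i => i l), f n :=
          (Finset.prod_univ_sum _ (fun _ n => f n)).symm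
      _ ≤ _ := by
          apply Finset.prod_le_prod
          · intro l _; exact Finset.sum_nonneg (fun n _ => hf0 n)
          · intro l _; exact hf.sum_le_tsum _ (fun n _ => hf0 n)

lemma rho_ge {d : ℕ} (β : Fin d → ℝ) (hβ : ∀ l, 0 < β l) (i : Fin d → ℤ) (hi : i ≠ 0) :
    1 ≤ ∑ l, |(i l : ℝ)| ^ β l ∧
      ∀ l, (max 1 |(i l : ℝ)|) ^ β l ≤ ∑ l, |(i l : ℝ)| ^ β l := by
  have hle : ∀ l, |(i l : ℝ)| ^ β l ≤ ∑ l, |(i l : ℝ)| ^ β l := fun l =>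
    Finset.single_le_sum (f := fun l => |(i l : ℝ)| ^ β l)
      (fun i _ => by positivity) (Finset.mem_univ l)
  have h1 : 1 ≤ ∑ l, |(i l : ℝ)| ^ β l := by
    obtain ⟨l, hl⟩ := Function.ne_iff.1 hi
    have h : (1:ℝ) ≤ |(i l:ℝ)| := by exact_mod_cast Int.one_le_abs hl
    exact (Real.one_le_rpow h (hβ l).le).trans (hle l)
  refine ⟨h1, fun l => ?_⟩
  rcases le_total 1 |(i l : ℝ)| with h | h
  · rw [max_eq_right h]; exact hle l
  · rw [max_eq_left h, Real.one_rpow]; exact h1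

lemma summable_rho {d : ℕ} (β : Fin d → ℝ) (hβ : ∀ l, 0 < β l) (Q : ℝ)
    (hQ : Q = ∑ l, (β l)⁻¹) (hQ0 : 0 < Q) (s : ℝ) (hs : Q < s) :
    Summable (fun i : Fin d → ℤ =>
        if i = 0 then 0 else (∑ l, |(i l : ℝ)| ^ β l) ^ (-s)) := by
  have h := summable_pi_prod (d := d) _ (fun n => by positivity)
    (summable_int_max (s / Q) ((one_lt_div hQ0).2 hs))
  refine Summable.of_nonneg_of_le (fun i => ?_) (fun i => ?_) h
  · split_ifs <;> positivity
  · split_ifs with hi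
    · positivity
    · obtain ⟨h1, h2⟩ := rho_ge β hβ i hi
      exact prod_rpow_le β hβ Q hQ hQ0 s (by linarith) _ (fun l => by positivity) _
        (by linarith) h2

lemma not_summable_rho {d : ℕ} (hd : 0 < d) (β : Fin d → ℝ) (hβ : ∀ l, 0 < β l) (Q : ℝ)
    (hQ : Q = ∑ l, (β l)⁻¹) (γ : ℝ) (hγ : 0 < γ) (hs : γ ≤ Q) :
    ¬ Summable (fun i : Fin d → ℤ =>
        if i = 0 then 0 else (∑ l, |(i l : ℝ)| ^ β l) ^ (-γ)) := by
  intro hsum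
  have hd' : (0:ℝ) < d := by exact_mod_cast hd
  let t : ℕ → ℝ := fun n => (n:ℝ) + 1
  have ht1 : ∀ n, 1 ≤ t n := fun n => by simp [t]
  have ht0 : ∀ n, 0 < t n := fun n => by positivity
  have htl : Tendsto t atTop atTop := tendsto_atTop_add_const_right _ _ tendsto_natCast_atTop_atTop
  let P : ℕ → Finset (Fin d → ℤ) := fun n =>
    Fintype.piFinset (fun l => Finset.Icc 1 ⌊t n ^ (β l)⁻¹⌋)
  have h := tendsto_tsum_of_dominated_convergence (𝓕 := atTop)
    (f := fun n i => if i ∈ P n then (d * t n) ^ (-γ) else 0) (g := fun _ => 0) hsum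
    (fun i => by
      have h3 : Tendsto (fun n => (d * t n) ^ (-γ)) atTop (𝓝 0) :=
        (tendsto_rpow_neg_atTop hγ).comp (htl.const_mul_atTop hd')
      refine tendsto_of_tendsto_of_tendsto_of_le_of_le tendsto_const_nhds h3 (fun n => ?_)
        (fun n => ?_)
      · have := ht0 n
        simp only; split_ifs <;> positivity
      · have := ht0 n
        simp only; split_ifs
        · exact le_rfl
        · positivity)
    (Eventually.of_forall fun n i => by
      have hn := ht0 n
      by_cases hi : i ∈ P n
      · have hm : ∀ l, 1 ≤ i l ∧ i l ≤ ⌊t n ^ (β l)⁻¹⌋ := by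
          intro l
          have := Fintype.mem_piFinset.1 hi l
          simpa using this
        have hi0 : i ≠ 0 := by
          rintro rfl
          have := (hm ⟨0, hd⟩).1
          simp at this
        rw [if_pos hi, if_neg hi0, Real.norm_of_nonneg (by positivity)]
        obtain ⟨h1, -⟩ := rho_ge β hβ i hi0
        apply Real.rpow_le_rpow_of_nonpos (by linarith) _ (by linarith)
        have : ∀ l ∈ Finset.univ, |(i l : ℝ)| ^ β l ≤ t n := by
          intro l _
          have a1 : (1:ℝ) ≤ i l := by exact_mod_cast (hm l).1
          have a2 : (i l : ℝ) ≤ t n ^ (β l)⁻¹ := Int.le_floor.1 (hm l).2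
          rw [abs_of_nonneg (by linarith)]
          have := Real.rpow_le_rpow (by linarith) a2 (hβ l).le
          rwa [Real.rpow_inv_rpow hn.le (hβ l).ne'] at this
        simpa using Finset.sum_le_card_nsmul _ _ _ this
      · rw [if_neg hi]
        split_ifs
        · simp
        · simp; positivity)
  simp only [tsum_zero] at h
  have hlow : ∀ n, (d:ℝ) ^ (-γ) * (1/2) ^ d ≤
      ∑' i : Fin d → ℤ, if i ∈ P n then (d * t n) ^ (-γ) else 0 := by
    intro n
    have hn := ht0 n
    rw [tsum_eq_sum (s := P n) (fun i hi => if_neg hi), Finset.sum_congr rfl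
      (fun i hi => if_pos hi), Finset.sum_const, nsmul_eq_mul]
    have hcard : (1/2 : ℝ) ^ d * t n ^ Q ≤ ((P n).card : ℝ) := by
      have e : (1/2 : ℝ) ^ d * t n ^ Q = ∏ l, (1/2 * t n ^ (β l)⁻¹) := by
        rw [Finset.prod_mul_distrib, ← Real.rpow_sum_of_pos hn, ← hQ]; simp
      rw [e, Fintype.card_piFinset, Nat.cast_prod]
      apply Finset.prod_le_prod (fun l _ => by positivity)
      intro l _
      have a4 : 1 ≤ t n ^ (β l)⁻¹ := Real.one_le_rpow (ht1 n) (inv_nonneg.2 (hβ l).le)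
      have a5 : 1 ≤ ⌊t n ^ (β l)⁻¹⌋ := by rw [Int.le_floor]; simpa using a4
      have a6 := Int.lt_floor_add_one (t n ^ (β l)⁻¹)
      rw [Int.card_Icc]
      have a7 : (((⌊t n ^ (β l)⁻¹⌋ + 1 - 1).toNat : ℕ) : ℝ) = (⌊t n ^ (β l)⁻¹⌋ : ℝ) := by
        have : ((⌊t n ^ (β l)⁻¹⌋ + 1 - 1).toNat : ℤ) = ⌊t n ^ (β l)⁻¹⌋ := by omega
        exact_mod_cast this
      rw [a7]
      have a8 : (1:ℝ) ≤ (⌊t n ^ (β l)⁻¹⌋ : ℝ) := by exact_mod_cast a5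
      linarith
    calc (d:ℝ) ^ (-γ) * (1/2) ^ d ≤ (d:ℝ) ^ (-γ) * (1/2) ^ d * (t n ^ (Q + -γ)) := by
          apply le_mul_of_one_le_right (by positivity)
          exact Real.one_le_rpow (ht1 n) (by linarith)
      _ = ((1/2) ^ d * t n ^ Q) * (d * t n) ^ (-γ) := by
          rw [Real.rpow_add hn, Real.mul_rpow hd'.le hn.le]; ring
      _ ≤ _ := by gcongr
  have h2 : (d:ℝ) ^ (-γ) * (1/2) ^ d ≤ 0 := ge_of_tendsto h (Eventually.of_forall hlow)
  have h3 : 0 < (d:ℝ) ^ (-γ) * (1/2) ^ d := by positivity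
  linarith

lemma slow_bound (L : ℝ → ℝ) (α : ℝ) (hα2 : α ≤ 2) (hL : SlowlyVarying L)
    (hpos : ∀ x : ℝ, 0 < x → 0 < L x)
    (hmono : ∀ x y : ℝ, 0 < x → x ≤ y → x ^ (2 - α) * L x ≤ y ^ (2 - α) * L y)
    (ε : ℝ) (hε : 0 < ε) : ∃ C : ℝ, 0 ≤ C ∧ ∀ x, 1 ≤ x → L x ≤ C * x ^ ε := by
  have h2 : (1:ℝ) < 2 ^ ε := Real.one_lt_rpow (by norm_num) hε
  have hev := (hL 2 (by norm_num)).eventually (gt_mem_nhds h2)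
  obtain ⟨X, hX⟩ := eventually_atTop.1 hev
  set M : ℝ := max X 1 with hM
  have hM1 : 1 ≤ M := le_max_right _ _
  have hstep : ∀ x, M ≤ x → L (2 * x) ≤ 2 ^ ε * L x := by
    intro x hx
    have hx0 : 0 < x := by linarith
    have := hX x ((le_max_left _ _).trans hx)
    rw [div_lt_iff₀ (hpos x hx0)] at this
    exact this.le
  -- bound on [1, 2M]
  set C : ℝ := (2 * M) ^ (2 - α) * L (2 * M) with hC
  have hC0 : 0 ≤ C := by
    have := hpos (2 * M) (by linarith)
    positivity
  have hbase : ∀ x, 1 ≤ x → x ≤ 2 * M → L x ≤ C * x ^ ε := by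
    intro x h1 hx
    have a := hmono x (2 * M) (by linarith) hx
    have b : 1 ≤ x ^ (2 - α) := Real.one_le_rpow h1 (by linarith)
    have c : 1 ≤ x ^ ε := Real.one_le_rpow h1 hε.le
    have := hpos x (by linarith)
    nlinarith
  refine ⟨C, hC0, ?_⟩
  have hind : ∀ n : ℕ, ∀ x, 1 ≤ x → x ≤ 2 ^ n * (2 * M) → L x ≤ C * x ^ ε := by
    intro n
    induction n with
    | zero => intro x h1 hx; exact hbase x h1 (by simpa using hx)
    | succ n ih =>
      intro x h1 hx
      rcases le_total x (2 * M) with h | h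
      · exact hbase x h1 h
      · have i1 := ih (x / 2) (by linarith) (by rw [pow_succ] at hx; linarith)
        have i2 := hstep (x / 2) (by linarith)
        rw [mul_div_cancel₀ x (by norm_num : (2:ℝ) ≠ 0)] at i2
        have e : x ^ ε = 2 ^ ε * (x / 2) ^ ε := by
          rw [← Real.mul_rpow (by norm_num) (by linarith), mul_div_cancel₀ x (by norm_num : (2:ℝ) ≠ 0)]
        rw [e]
        nlinarith
  intro x hx
  obtain ⟨n, hn⟩ := pow_unbounded_of_one_lt x (by norm_num : (1:ℝ) < 2)
  refine hind n x hx (hn.le.trans ?_)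
  have : (0:ℝ) < 2 ^ n := by positivity
  nlinarith

/-- anisotropic coefficients `a_i = (Σ_l |i_l|^{β_l})^{-γ}`:
integral test, divergence of `Σ|a_i|`, and summability of `Σ|a_i|^α L(1/|a_i|)`. -/
theorem stmt19
    (d : ℕ) (hd : 0 < d) (α γ : ℝ) (hα : 0 < α) (hα2 : α ≤ 2) (hγ : 0 < γ)
    (β : Fin d → ℝ) (hβ : ∀ l, 0 < β l)
    (Q : ℝ) (hQ : Q = ∑ l, (β l)⁻¹) :
    -- (i) the integral test
    ((∫⁻ y : Fin d → ℝ,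
        (∫⁻ x in Set.univ.pi fun _ => Set.Icc (-1:ℝ) 1,
          ENNReal.ofReal ((∑ l, |x l - y l| ^ β l) ^ (-γ))) ^ α) < ⊤ ↔
      (Q < α * γ ∧ γ < Q)) ∧
    -- (ii) `Σ_i |a_i| = ∞ ↔ γ ≤ Q`
    (¬ Summable (fun i : Fin d → ℤ =>
        if i = 0 then 0 else (∑ l, |(i l : ℝ)| ^ β l) ^ (-γ)) ↔ γ ≤ Q) ∧
    -- (iii) `αγ > Q` implies `Σ_i (Σ_l |i_l|^{β_l})^{-αγ} L((Σ_l |i_l|^{β_l})^γ) < ∞`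
    (Q < α * γ →
      ∀ (L : ℝ → ℝ) (bL : ℝ), SlowlyVarying L → (∀ x : ℝ, 0 < x → 0 < L x) →
        1 ≤ bL → (∀ x : ℝ, 0 < x → x ≤ bL → L x = L bL) →
        (∀ x y : ℝ, 0 < x → x ≤ y → x ^ (2 - α) * L x ≤ y ^ (2 - α) * L y) →
        Summable (fun i : Fin d → ℤ =>
          if i = 0 then 0 else
            (∑ l, |(i l : ℝ)| ^ β l) ^ (-(α * γ)) * L ((∑ l, |(i l : ℝ)| ^ β l) ^ γ))) := by
  have hQ0 : 0 < Q := by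
    rw [hQ]
    have : Nonempty (Fin d) := ⟨⟨0, hd⟩⟩
    exact Finset.sum_pos (fun l _ => inv_pos.2 (hβ l)) Finset.univ_nonempty
  refine ⟨⟨fun h => ⟨?_, ?_⟩, fun h => ?_⟩, ⟨fun h => ?_, fun h => ?_⟩, ?_⟩
  · by_contra hc
    exact h.ne (part_i_alpha hd α γ hα hγ β hβ Q hQ (not_lt.1 hc))
  · by_contra hc
    exact h.ne (part_i_gamma hd α γ hα hγ β hβ Q hQ (not_lt.1 hc))
  · exact part_i_fin hd α γ hα hγ β hβ Q hQ hQ0 h.1 h.2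
  · by_contra hc
    exact h (summable_rho β hβ Q hQ hQ0 γ (not_le.1 hc))
  · exact not_summable_rho hd β hβ Q hQ γ hγ h
  · intro h L bL hL hpos _ _ hmono
    obtain ⟨C, hC, hb⟩ := slow_bound L α hα2 hL hpos hmono ((α * γ - Q) / (2 * γ))
      (div_pos (by linarith) (by linarith))
    have hs := (summable_rho β hβ Q hQ hQ0 ((α * γ + Q) / 2) (by linarith)).mul_left C
    refine Summable.of_nonneg_of_le (fun i => ?_) (fun i => ?_) hs
    · split_ifs with hi
      · exact le_rfl
      · obtain ⟨h1, -⟩ := rho_ge β hβ i hi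
        have := hpos ((∑ l, |(i l : ℝ)| ^ β l) ^ γ) (Real.rpow_pos_of_pos (by linarith) _)
        positivity
    · split_ifs with hi
      · simp
      · obtain ⟨h1, -⟩ := rho_ge β hβ i hi
        set r := ∑ l, |(i l : ℝ)| ^ β l
        have hr : 0 < r := by linarith
        have h2 := hb (r ^ γ) (Real.one_le_rpow h1 hγ.le)
        calc r ^ (-(α * γ)) * L (r ^ γ) ≤
            r ^ (-(α * γ)) * (C * (r ^ γ) ^ ((α * γ - Q) / (2 * γ))) := by gcongr
          _ = C * r ^ (-((α * γ + Q) / 2)) := by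
            rw [← Real.rpow_mul hr.le, mul_left_comm, ← Real.rpow_add hr]
            congr 2; field_simp; ring

end
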